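/- For every c with −1/2 < c < 0 and every x > 0: (1/(2πi)) ∫_{Re s = c} Γ(s/2) x^{−s} ds = 2(e^{−x²} − 1). -/

import Mathlib

open Complex

open Set Filter Topology MeasureTheory Asymptotics

/-- On the right half-plane, `Γ` is bounded in norm by its value at the real part. -/
theorem norm_Gamma_le_Gamma_re {s : ℂ} (hs : 0 < s.re) :
    ‖Complex.Gamma s‖ ≤ Real.Gamma s.re := by
  rw [Complex.Gamma_eq_integral hs, Real.Gamma_eq_integral hs, Complex.GammaIntegral]
  refine (norm_integral_le_integral_norm _).trans_eq ?_
  refine setIntegral_congr_fun measurableSet_Ioi fun t ht => ?_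
  simp only [norm_mul, norm_real, Real.norm_eq_abs, Real.abs_exp]
  rw [norm_cpow_eq_rpow_re_of_pos ht]
  simp

/-- `Γ` is integrable along vertical lines in the strip `-1/2 < Re s < 0`. -/
theorem verticalIntegrable_Gamma {σ : ℝ} (h₁ : -(1 / 2) < σ) (h₂ : σ < 0) :
    VerticalIntegrable Complex.Gamma σ := by
  have hre (y : ℝ) : ((σ : ℂ) + y * I).re = σ := by simp
  have him (y : ℝ) : ((σ : ℂ) + y * I).im = y := by simp
  have hcont : Continuous fun y : ℝ => Complex.Gamma (σ + y * I) := by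
    refine continuous_iff_continuousAt.2 fun y => ?_
    refine ContinuousAt.comp (g := Complex.Gamma) (continuousAt_Gamma _ fun m hm => ?_)
      (by fun_prop)
    have h := congrArg Complex.re hm
    rw [hre, neg_re, natCast_re] at h
    have hm0 : 0 < m := Nat.pos_of_ne_zero fun h0 => by simp [h0] at h; linarith
    have : (1 : ℝ) ≤ m := by exact_mod_cast hm0
    linarith
  refine (integrable_inv_one_add_sq.const_mul (Real.Gamma (σ + 2) / σ ^ 2)).mono'
    hcont.aestronglyMeasurable (Eventually.of_forall fun y => ?_)
  set s : ℂ := σ + y * I with hs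
  have hs0 : s ≠ 0 := fun h => by
    have := congrArg Complex.re h
    rw [hre, zero_re] at this
    linarith
  have hs1 : s + 1 ≠ 0 := fun h => by
    have := congrArg Complex.re h
    rw [add_re, hre, zero_re, one_re] at this
    linarith
  have hG : Complex.Gamma (s + 2) = (s + 1) * (s * Complex.Gamma s) := by
    rw [← Complex.Gamma_add_one s hs0, ← Complex.Gamma_add_one _ hs1]
    ring_nf
  have hle : ‖s + 1‖ * (‖s‖ * ‖Complex.Gamma s‖) ≤ Real.Gamma (σ + 2) := by
    rw [← norm_mul, ← norm_mul, ← hG]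
    have hre2 : (s + 2).re = σ + 2 := by simp [hs]
    simpa only [hre2] using norm_Gamma_le_Gamma_re (s := s + 2) (by rw [hre2]; linarith)
  have hsq : ‖s‖ ^ 2 = σ ^ 2 + y ^ 2 := by
    rw [Complex.sq_norm, normSq_apply, hre, him]; ring
  have hsq1 : ‖s + 1‖ ^ 2 = (σ + 1) ^ 2 + y ^ 2 := by
    rw [Complex.sq_norm, normSq_apply, add_re, add_im, hre, him, one_re, one_im]; ring
  have hmono : ‖s‖ ≤ ‖s + 1‖ := by
    refine abs_le_of_sq_le_sq' ?_ (norm_nonneg _) |>.2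
    rw [hsq, hsq1]; nlinarith
  have hσ : 0 < σ ^ 2 := sq_pos_of_neg h₂
  rw [← div_eq_mul_inv, div_div, le_div_iff₀ (by positivity)]
  have hbound : σ ^ 2 * (1 + y ^ 2) ≤ ‖s‖ ^ 2 := by
    rw [hsq]; nlinarith [sq_nonneg y, mul_nonneg (sq_nonneg y) (by nlinarith : 0 ≤ 1 - σ ^ 2)]
  calc ‖Complex.Gamma s‖ * (σ ^ 2 * (1 + y ^ 2)) ≤ ‖Complex.Gamma s‖ * ‖s‖ ^ 2 := by gcongr
    _ = ‖s‖ * (‖s‖ * ‖Complex.Gamma s‖) := by ring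
    _ ≤ ‖s + 1‖ * (‖s‖ * ‖Complex.Gamma s‖) := by gcongr
    _ ≤ _ := hle

theorem norm_exp_neg_sub_one_le_one {t : ℝ} (ht : 0 ≤ t) :
    ‖((Real.exp (-t) - 1 : ℝ) : ℂ)‖ ≤ 1 := by
  rw [norm_real, Real.norm_eq_abs, abs_le]
  have := Real.exp_pos (-t)
  have := Real.exp_le_one_iff.2 (neg_nonpos.2 ht)
  constructor <;> linarith

theorem norm_exp_neg_sub_one_le {t : ℝ} (ht : 0 ≤ t) :
    ‖((Real.exp (-t) - 1 : ℝ) : ℂ)‖ ≤ t := by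
  rw [norm_real, Real.norm_eq_abs, abs_le]
  have := Real.one_sub_le_exp_neg t
  have := Real.exp_le_one_iff.2 (neg_nonpos.2 ht)
  constructor <;> linarith

/-- The Mellin integral of `e⁻ᵗ - 1` converges in the strip `-1 < Re s < 0`. -/
theorem mellinConvergent_exp_neg_sub_one {s : ℂ} (h₁ : -1 < s.re) (h₂ : s.re < 0) :
    MellinConvergent (fun t : ℝ => ((Real.exp (-t) - 1 : ℝ) : ℂ)) s := by
  refine mellinConvergent_of_isBigO_rpow (a := 0) (b := -1) ?_ ?_ h₂ ?_ h₁
  · exact (Continuous.locallyIntegrable (by fun_prop)).locallyIntegrableOn _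
  · refine IsBigO.of_bound 1 ?_
    filter_upwards [eventually_ge_atTop 0] with t ht
    simpa using norm_exp_neg_sub_one_le_one ht
  · refine IsBigO.of_bound 1 ?_
    filter_upwards [self_mem_nhdsWithin] with t ht
    have ht : 0 < t := ht
    simpa [abs_of_pos ht] using norm_exp_neg_sub_one_le ht.le

/-- The Mellin transform of `e⁻ᵗ - 1` is `Γ` in the strip `-1 < Re s < 0`. -/
theorem mellin_exp_neg_sub_one {s : ℂ} (h₁ : -1 < s.re) (h₂ : s.re < 0) :
    mellin (fun t : ℝ => ((Real.exp (-t) - 1 : ℝ) : ℂ)) s = Complex.Gamma s := by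
  have hs0 : s ≠ 0 := fun h => by simp [h] at h₂
  have hs1 : 0 < (s + 1).re := by rw [add_re, one_re]; linarith
  let u : ℝ → ℂ := fun t => (t : ℂ) ^ s
  let u' : ℝ → ℂ := fun t => s * (t : ℂ) ^ (s - 1)
  let v : ℝ → ℂ := fun t => ((Real.exp (-t) - 1 : ℝ) : ℂ)
  let v' : ℝ → ℂ := fun t => ((-Real.exp (-t) : ℝ) : ℂ)
  have hu : ∀ t ∈ Ioi (0 : ℝ), HasDerivAt u (u' t) t := fun t ht => by
    have := (hasDerivAt_id (t : ℂ)).cpow_const (c := s) (ofReal_mem_slitPlane.2 ht)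
    simpa [u, u'] using this.comp_ofReal
  have hv : ∀ t ∈ Ioi (0 : ℝ), HasDerivAt v (v' t) t := fun t _ => by
    have := ((Real.hasDerivAt_exp (-t)).comp t (hasDerivAt_neg t)).sub_const 1
    simpa [v, v', Function.comp_def] using this.ofReal_comp
  have huv' : IntegrableOn (u * v') (Ioi 0) := by
    refine (Complex.GammaIntegral_convergent hs1).neg.congr_fun (fun t _ => ?_) measurableSet_Ioi
    simp [u, v', mul_comm]
  have hu'v : IntegrableOn (u' * v) (Ioi 0) := by
    refine IntegrableOn.congr_fun ((mellinConvergent_exp_neg_sub_one h₁ h₂).const_mul s)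
      (fun t _ => ?_) measurableSet_Ioi
    simp [u', v, mul_assoc]
  have h_zero : Tendsto (u * v) (𝓝[>] 0) (𝓝 0) := by
    have hlim : Tendsto (fun t : ℝ => t ^ (s.re + 1)) (𝓝[>] 0) (𝓝 0) := by
      have := (Real.continuousAt_rpow_const 0 (s.re + 1) (Or.inr (by linarith))).tendsto
      rw [Real.zero_rpow (by linarith)] at this
      exact this.mono_left nhdsWithin_le_nhds
    refine squeeze_zero_norm' ?_ hlim
    filter_upwards [self_mem_nhdsWithin] with t ht
    have ht : 0 < t := ht
    rw [Pi.mul_apply, norm_mul, norm_cpow_eq_rpow_re_of_pos ht, Real.rpow_add_one ht.ne']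
    gcongr
    exact norm_exp_neg_sub_one_le ht.le
  have h_infty : Tendsto (u * v) atTop (𝓝 0) := by
    have hlim : Tendsto (fun t : ℝ => t ^ s.re) atTop (𝓝 0) := by
      simpa using tendsto_rpow_neg_atTop (y := -s.re) (by linarith)
    refine squeeze_zero_norm' ?_ hlim
    filter_upwards [eventually_gt_atTop 0] with t ht
    rw [Pi.mul_apply, norm_mul, norm_cpow_eq_rpow_re_of_pos ht]
    exact mul_le_of_le_one_right (by positivity) (norm_exp_neg_sub_one_le_one ht.le)
  have hparts := integral_Ioi_mul_deriv_eq_deriv_mul hu hv huv' hu'v h_zero h_infty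
  have hleft : ∫ t in Ioi (0 : ℝ), u t * v' t = -Complex.Gamma (s + 1) := by
    rw [Complex.Gamma_eq_integral hs1, Complex.GammaIntegral, ← integral_neg]
    refine setIntegral_congr_fun measurableSet_Ioi fun t _ => ?_
    simp [u, v', mul_comm]
  have hright : ∫ t in Ioi (0 : ℝ), u' t * v t = s * mellin v s := by
    simp only [mellin, ← integral_const_mul, u', smul_eq_mul, mul_assoc]
  rw [hleft, hright, Complex.Gamma_add_one s hs0, sub_zero, zero_sub, neg_inj] at hparts
  exact (mul_left_cancel₀ hs0 hparts).symm

/-- For `-1/2 < c < 0` and `x > 0`,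
`Z_{1,0}(x) = (1/(2πi)) ∫_{Re s = c} Γ(s/2) x^{-s} ds = 2(e^{-x²} - 1)`. -/
theorem Z_one_zero_eval (c : ℝ) (hc₁ : -(1/2) < c) (hc₂ : c < 0)
    (x : ℝ) (hx : 0 < x) :
    mellinInv c (fun s => Complex.Gamma (s / 2)) x
      = ((2 * (Real.exp (-x ^ 2) - 1) : ℝ) : ℂ) := by
  let g : ℝ → ℂ := fun t => (2 : ℂ) • ((Real.exp (-t ^ (2 : ℝ)) - 1 : ℝ) : ℂ)
  have hre (y : ℝ) : (((c : ℂ) + y * I) / 2).re = c / 2 := by simp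
  have hmellin (y : ℝ) : mellin g (c + y * I) = Complex.Gamma ((c + y * I) / 2) := by
    rw [mellin_const_smul,
      mellin_comp_rpow (fun t : ℝ => ((Real.exp (-t) - 1 : ℝ) : ℂ)) _ 2, ofReal_ofNat,
      mellin_exp_neg_sub_one (by rw [hre]; linarith) (by rw [hre]; linarith)]
    simp
  have hconv : MellinConvergent g c := by
    refine MellinConvergent.const_smul ?_ (2 : ℂ)
    refine (MellinConvergent.comp_rpow (f := fun t : ℝ => ((Real.exp (-t) - 1 : ℝ) : ℂ))
      two_ne_zero).2 (mellinConvergent_exp_neg_sub_one ?_ ?_) <;>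
    · rw [← ofReal_div, ofReal_re]
      linarith
  have hvert : VerticalIntegrable (mellin g) c := by
    have h := verticalIntegrable_Gamma (σ := c / 2) (by linarith) (by linarith)
    refine (Integrable.comp_div h two_ne_zero).congr (Eventually.of_forall fun y => ?_)
    simp only [hmellin]
    congr 1
    push_cast
    ring
  have hcont : ContinuousAt g x := by
    have := Real.continuousAt_rpow_const x 2 (Or.inl hx.ne')
    fun_prop
  have hinv : mellinInv c (fun s => Complex.Gamma (s / 2)) x = mellinInv c (mellin g) x := by
    simp only [mellinInv, hmellin]
  rw [hinv, mellinInv_mellin_eq c g hx hconv hvert hcont]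
  simp [g]
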